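/- The reflexive tournaments C₃ and C₃⁺ are not siblings; that is, there is no finite reflexive tournament T admitting surjective homomorphisms both onto C₃ and onto C₃⁺. -/

import Mathlib

/-- A reflexive tournament: a reflexive binary relation such that for all `x ≠ y`
exactly one of `x → y`, `y → x` holds. -/
def IsReflTournament {T : Type*} (r : T → T → Prop) : Prop :=
  (∀ x, r x x) ∧ ∀ x y : T, x ≠ y → (r x y ∨ r y x) ∧ ¬(r x y ∧ r y x)

/-- The reflexive tournament `C₃` on `{1,2,3}` with nontrivial edges
`1 → 2`, `2 → 3`, `3 → 1`. -/
def c3 : Fin 3 → Fin 3 → Prop := fun x y =>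
  x = y ∨ (x, y) = (0, 1) ∨ (x, y) = (1, 2) ∨ (x, y) = (2, 0)

/-- The reflexive tournament `C₃⁺` on `{1,2,3,4}` with nontrivial edges
`1 → 2`, `2 → 3`, `3 → 1`, `1 → 4`, `2 → 4`, `3 → 4`. -/
def c3plus : Fin 4 → Fin 4 → Prop := fun x y =>
  x = y ∨ (x, y) = (0, 1) ∨ (x, y) = (1, 2) ∨ (x, y) = (2, 0) ∨
    (x, y) = (0, 3) ∨ (x, y) = (1, 3) ∨ (x, y) = (2, 3)

theorem not_c3_add_one (i : Fin 3) : ¬ c3 (i + 1) i := by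
  unfold c3
  revert i
  decide

/-- The vertex `3` is a sink of `C₃⁺`. -/
theorem c3plus_three {b : Fin 4} (h : c3plus 3 b) : b = 3 := by
  unfold c3plus at h
  revert b
  decide

theorem rel_of_map_eq_add_one {T : Type*} {r : T → T → Prop} (hr : IsReflTournament r)
    {f : T → Fin 3} (hf : ∀ x y, r x y → c3 (f x) (f y)) {x y : T} (h : f y = f x + 1) :
    r x y := by
  have hyx : ¬ r y x := fun hyx => not_c3_add_one (f x) (h ▸ hf y x hyx)
  have hne : x ≠ y := by
    rintro rfl
    exact hyx (hr.1 x)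
  exact (hr.2 x y hne).1.resolve_right hyx

/-- Lemma 7.1. `C₃` and `C₃⁺` are not siblings: there is no finite
reflexive tournament `T` admitting surjective homomorphisms onto both `C₃` and
`C₃⁺`. -/
theorem stmt18 :
    ¬ ∃ (T : Type) (_ : Fintype T) (rT : T → T → Prop),
      IsReflTournament rT ∧
      (∃ f : T → Fin 3, Function.Surjective f ∧
        ∀ x y, rT x y → c3 (f x) (f y)) ∧
      (∃ g : T → Fin 4, Function.Surjective g ∧
        ∀ x y, rT x y → c3plus (g x) (g y)) := by
  rintro ⟨T, _, r, hr, ⟨f, hf_surj, hf⟩, g, hg_surj, hg⟩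
  have step {x y : T} (h : f y = f x + 1) (hx : g x = 3) : g y = 3 :=
    c3plus_three (hx ▸ hg x y (rel_of_map_eq_add_one hr hf h))
  obtain ⟨a, ha⟩ := hg_surj 3
  obtain ⟨b, hb⟩ := hf_surj (f a + 1)
  obtain ⟨c, hc⟩ := hf_surj (f b + 1)
  have hgb := step hb ha
  have hgc := step hc hgb
  obtain ⟨y, hy⟩ := hg_surj 0
  have cover : ∀ i j : Fin 3, j = i + 1 ∨ j = i + 1 + 1 ∨ j = i + 1 + 1 + 1 := by decide
  have hgy : g y = 3 := by
    rcases cover (f a) (f y) with h | h | h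
    · exact step h ha
    · exact step (hb ▸ h) hgb
    · exact step (by rw [h, hc, hb]) hgc
  exact absurd (hy.symm.trans hgy) (by decide)
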